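/- In the perturbed Gaussian setting (standard normal ρ_X on ℝ^n, f continuously differentiable with ρ_X-square-integrable gradient, eigenvalues λ₁ ≥ ⋯ ≥ λ_n ≥ 0 of C = ∫ ∇f ∇fᵀ ρ_X dx with eigenvector matrix W, orthogonal Ŵ = [Ŵ₁ Ŵ₂] with ‖W − Ŵ‖ ≤ ε, and f_{ĝ_N}(x,ω) = ĝ_N(Ŵ₁ᵀx,ω) the N-sample Monte Carlo ridge approximation built from i.i.d. samples with density φ_{n−k}), it holds that E[ ∫_{ℝ^n} (f(x) − f_{ĝ_N}(x,·))² ρ_X(x) dx ] ≤ (1 + N^{−1/2})² ( ε(λ₁ + ⋯ + λ_k)^{1/2} + (λ_{k+1} + ⋯ + λ_n)^{1/2} )². -/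

import Mathlib

open MeasureTheory Matrix Set ProbabilityTheory
open scoped Matrix.Norms.L2Operator

/-- The standard normal density on `ℝ^n`. -/
noncomputable def gaussDensity (n : ℕ) (x : Fin n → ℝ) : ℝ :=
  (2 * Real.pi) ^ (-(n : ℝ) / 2) * Real.exp (-(∑ i, x i ^ 2) / 2)

/-- The vector of partial derivatives (gradient) of `f : ℝ^n → ℝ`. -/
noncomputable def pgrad {n : ℕ} (f : (Fin n → ℝ) → ℝ) (x : Fin n → ℝ) : Fin n → ℝ :=
  fun i => fderiv ℝ f x (Pi.single i 1)


lemma aux_half_fin (u u' : ℝ → ℝ) (hu : ∀ t, HasDerivAt u (u' t) t) (hc : Continuous u')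
    (h0 : u 0 = 0) (b : ℝ) (hb : 0 < b) :
    ∫ t in (0:ℝ)..b, u t ^ 2 * Real.exp (-t ^ 2 / 2) ≤
      ∫ t in (0:ℝ)..b, u' t ^ 2 * Real.exp (-t ^ 2 / 2) := by
  have huc : Continuous u := continuous_iff_continuousAt.2 fun t => (hu t).continuousAt
  have hi : ∀ a c : ℝ, IntervalIntegrable (fun t => u t ^ 2 * Real.exp (-t ^ 2 / 2)) volume a c :=
    fun a c => (by fun_prop : Continuous _).intervalIntegrable _ _
  have hi' : ∀ a c : ℝ, IntervalIntegrable (fun t => u' t ^ 2 * Real.exp (-t ^ 2 / 2)) volume a c :=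
    fun a c => (by fun_prop : Continuous _).intervalIntegrable _ _
  have key : ∀ a ∈ Ioo 0 b, ∫ t in a..b, u t ^ 2 * Real.exp (-t ^ 2 / 2) ≤
      (∫ t in a..b, u' t ^ 2 * Real.exp (-t ^ 2 / 2)) +
        (u a / a) * u a * Real.exp (-a ^ 2 / 2) := by
    intro a ha
    have hpos : ∀ t ∈ uIcc a b, 0 < t := by
      intro t ht
      rw [uIcc_of_le ha.2.le] at ht
      exact ha.1.trans_le ht.1
    have hd : ∀ t ∈ uIcc a b, HasDerivAt (fun t => (u t / t) * u t * Real.exp (-t ^ 2 / 2))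
        ((2 * u t * u' t / t - u t ^ 2 / t ^ 2 - u t ^ 2) * Real.exp (-t ^ 2 / 2)) t := by
      intro t ht
      have ht0 := (hpos t ht).ne'
      have h1 : HasDerivAt (fun t : ℝ => Real.exp (-t ^ 2 / 2))
          (Real.exp (-t ^ 2 / 2) * (-(2 * t) / 2)) t := by
        have := (((hasDerivAt_pow 2 t).neg).div_const 2).exp
        simpa using this
      have := (((hu t).div (hasDerivAt_id t) ht0).mul (hu t)).mul h1
      refine this.congr_deriv ?_
      simp only [id, Pi.mul_apply, Pi.div_apply]
      field_simp
      ring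
    have hIntg : IntervalIntegrable (fun t =>
        (2 * u t * u' t / t - u t ^ 2 / t ^ 2 - u t ^ 2) * Real.exp (-t ^ 2 / 2)) volume a b := by
      apply ContinuousOn.intervalIntegrable
      have h0 : ∀ t ∈ uIcc a b, t ≠ 0 := fun t ht => (hpos t ht).ne'
      have h2 : ∀ t ∈ uIcc a b, t ^ 2 ≠ 0 := fun t ht => pow_ne_zero _ (h0 t ht)
      fun_prop (disch := assumption)
    have hftc := intervalIntegral.integral_eq_sub_of_hasDerivAt hd hIntg
    have hmono : ∫ t in a..b, (u t ^ 2 * Real.exp (-t ^ 2 / 2) +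
        (2 * u t * u' t / t - u t ^ 2 / t ^ 2 - u t ^ 2) * Real.exp (-t ^ 2 / 2)) ≤
        ∫ t in a..b, u' t ^ 2 * Real.exp (-t ^ 2 / 2) := by
      apply intervalIntegral.integral_mono_on ha.2.le ((hi a b).add hIntg) (hi' a b)
      intro t ht
      have ht0 : t ≠ 0 := (ha.1.trans_le ht.1).ne'
      rw [← add_mul]
      apply mul_le_mul_of_nonneg_right _ (Real.exp_pos _).le
      have h := sq_nonneg (u' t - u t / t)
      have e : (u' t - u t / t) ^ 2 = u' t ^ 2 - (2 * u t * u' t / t - u t ^ 2 / t ^ 2) := by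
        field_simp
        ring
      linarith
    rw [intervalIntegral.integral_add (hi a b) hIntg, hftc] at hmono
    have hb' : 0 ≤ (u b / b) * u b * Real.exp (-b ^ 2 / 2) := by
      have : (u b / b) * u b = u b ^ 2 / b := by ring
      rw [this]; positivity
    linarith
  have hne : (nhdsWithin (0:ℝ) (Ioi 0)).NeBot := inferInstance
  have t1 : Filter.Tendsto (fun a => ∫ t in a..b, u t ^ 2 * Real.exp (-t ^ 2 / 2))
      (nhdsWithin 0 (Ioi 0)) (nhds (∫ t in (0:ℝ)..b, u t ^ 2 * Real.exp (-t ^ 2 / 2))) := by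
    have : Continuous (fun a => ∫ t in a..b, u t ^ 2 * Real.exp (-t ^ 2 / 2)) := by
      simp_rw [intervalIntegral.integral_symm b]
      exact (intervalIntegral.continuous_primitive hi b).neg
    exact (this.tendsto 0).mono_left nhdsWithin_le_nhds
  have t2 : Filter.Tendsto (fun a => ∫ t in a..b, u' t ^ 2 * Real.exp (-t ^ 2 / 2))
      (nhdsWithin 0 (Ioi 0)) (nhds (∫ t in (0:ℝ)..b, u' t ^ 2 * Real.exp (-t ^ 2 / 2))) := by
    have : Continuous (fun a => ∫ t in a..b, u' t ^ 2 * Real.exp (-t ^ 2 / 2)) := by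
      simp_rw [intervalIntegral.integral_symm b]
      exact (intervalIntegral.continuous_primitive hi' b).neg
    exact (this.tendsto 0).mono_left nhdsWithin_le_nhds
  have t3 : Filter.Tendsto (fun a => (u a / a) * u a * Real.exp (-a ^ 2 / 2))
      (nhdsWithin 0 (Ioi 0)) (nhds (u' 0 * u 0 * Real.exp (-0 ^ 2 / 2))) := by
    have h1 : Filter.Tendsto (fun a => u a / a) (nhdsWithin 0 (Ioi 0)) (nhds (u' 0)) := by
      have := (hasDerivAt_iff_tendsto_slope.1 (hu 0)).mono_left
        (nhdsWithin_mono _ (fun x (hx : 0 < x) => hx.ne') : nhdsWithin (0:ℝ) (Ioi 0) ≤ _)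
      refine this.congr fun a => ?_
      simp [slope_def_field, h0]
    have h2 : Filter.Tendsto (fun a => u a) (nhdsWithin 0 (Ioi 0)) (nhds (u 0)) :=
      (huc.tendsto 0).mono_left nhdsWithin_le_nhds
    have h3 : Filter.Tendsto (fun a : ℝ => Real.exp (-a ^ 2 / 2)) (nhdsWithin 0 (Ioi 0))
        (nhds (Real.exp (-0 ^ 2 / 2))) :=
      ((by fun_prop : Continuous fun a : ℝ => Real.exp (-a ^ 2 / 2)).tendsto 0).mono_left
        nhdsWithin_le_nhds
    exact (h1.mul h2).mul h3
  have := le_of_tendsto_of_tendsto t1 (t2.add t3) (by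
    filter_upwards [Ioo_mem_nhdsGT hb] with a ha using key a ha)
  simpa [h0] using this

lemma aux_half (u u' : ℝ → ℝ) (hu : ∀ t, HasDerivAt u (u' t) t) (hc : Continuous u')
    (h0 : u 0 = 0) :
    ∫⁻ t in Ioi (0:ℝ), ENNReal.ofReal (u t ^ 2 * Real.exp (-t ^ 2 / 2)) ≤
      ∫⁻ t in Ioi (0:ℝ), ENNReal.ofReal (u' t ^ 2 * Real.exp (-t ^ 2 / 2)) := by
  have huc : Continuous u := continuous_iff_continuousAt.2 fun t => (hu t).continuousAt
  have hcov := aecover_Iic (μ := volume.restrict (Ioi (0:ℝ))) (tendsto_natCast_atTop_atTop (R := ℝ))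
  refine le_of_tendsto (hcov.lintegral_tendsto_of_nat (f := fun t =>
    ENNReal.ofReal (u t ^ 2 * Real.exp (-t ^ 2 / 2)))
    (by fun_prop : Measurable _).aemeasurable) ?_
  filter_upwards [Filter.eventually_gt_atTop 0] with n hn
  have hn' : (0:ℝ) < n := by exact_mod_cast hn
  rw [Measure.restrict_restrict measurableSet_Iic, inter_comm, Ioi_inter_Iic]
  have conv : ∀ v : ℝ → ℝ, Continuous v →
      ∫⁻ t in Ioc (0:ℝ) n, ENNReal.ofReal (v t ^ 2 * Real.exp (-t ^ 2 / 2)) =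
      ENNReal.ofReal (∫ t in (0:ℝ)..n, v t ^ 2 * Real.exp (-t ^ 2 / 2)) := by
    intro v hv
    rw [intervalIntegral.integral_of_le hn'.le, ofReal_integral_eq_lintegral_ofReal]
    · exact ((by fun_prop : Continuous fun t => v t ^ 2 * Real.exp (-t ^ 2 / 2)).intervalIntegrable
        0 n).1
    · exact ae_of_all _ fun t => by positivity
  rw [conv u huc]
  refine le_trans (ENNReal.ofReal_le_ofReal (aux_half_fin u u' hu hc h0 n hn')) ?_
  rw [← conv u' hc]
  exact lintegral_mono_set Ioc_subset_Ioi_self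

lemma aux_full (u u' : ℝ → ℝ) (hu : ∀ t, HasDerivAt u (u' t) t) (hc : Continuous u')
    (h0 : u 0 = 0) :
    ∫⁻ t, ENNReal.ofReal (u t ^ 2 * Real.exp (-t ^ 2 / 2)) ≤
      ∫⁻ t, ENNReal.ofReal (u' t ^ 2 * Real.exp (-t ^ 2 / 2)) := by
  have huc : Continuous u := continuous_iff_continuousAt.2 fun t => (hu t).continuousAt
  have hneg : ∀ F : ℝ → ENNReal, ∫⁻ t in Iio (0:ℝ), F t = ∫⁻ t in Ioi (0:ℝ), F (-t) := by
    intro F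
    have := (Measure.measurePreserving_neg (volume : Measure ℝ)).setLIntegral_comp_preimage_emb
      (MeasurableEquiv.neg ℝ).measurableEmbedding F (Iio 0)
    rw [← this]
    simp
  have hsplit : ∀ F : ℝ → ENNReal, ∫⁻ t, F t =
      (∫⁻ t in Ioi (0:ℝ), F t) + ∫⁻ t in Ioi (0:ℝ), F (-t) := by
    intro F
    rw [← hneg, ← lintegral_add_compl F (measurableSet_Ioi (a := (0:ℝ))), compl_Ioi,
      setLIntegral_congr Iio_ae_eq_Iic.symm]
  rw [hsplit, hsplit (fun t => ENNReal.ofReal (u' t ^ 2 * Real.exp (-t ^ 2 / 2)))]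
  gcongr 1 
  · exact aux_half u u' hu hc h0
  · have := aux_half (fun t => u (-t)) (fun t => - u' (-t)) (fun t => by
      have := (hu (-t)).scomp t (hasDerivAt_neg t)
      simpa [Function.comp_def] using this) (by fun_prop) (by simpa using h0)
    simpa using this

lemma gauss_lint (F : ℝ → ENNReal) (hF : Measurable F) : ∫⁻ t, F t ∂(gaussianReal 0 1) =
    ENNReal.ofReal ((√(2 * Real.pi))⁻¹) * ∫⁻ t, F t * ENNReal.ofReal (Real.exp (-t ^ 2 / 2)) := by
  rw [gaussianReal_of_var_ne_zero _ one_ne_zero,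
    lintegral_withDensity_eq_lintegral_mul _ (measurable_gaussianPDF 0 1) hF,
    ← lintegral_const_mul _ (by fun_prop)]
  congr 1 with t
  simp only [Pi.mul_apply, gaussianPDF, gaussianPDFReal]
  rw [ENNReal.ofReal_mul (by positivity)]
  simp
  ring

lemma aux_gauss (u u' : ℝ → ℝ) (hu : ∀ t, HasDerivAt u (u' t) t) (hc : Continuous u')
    (h0 : u 0 = 0) :
    ∫⁻ t, ENNReal.ofReal (u t ^ 2) ∂(gaussianReal 0 1) ≤
      ∫⁻ t, ENNReal.ofReal (u' t ^ 2) ∂(gaussianReal 0 1) := by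
  have huc : Continuous u := continuous_iff_continuousAt.2 fun t => (hu t).continuousAt
  rw [gauss_lint _ (by fun_prop), gauss_lint _ (by fun_prop)]
  simp_rw [← ENNReal.ofReal_mul (sq_nonneg _)]
  gcongr 1
  exact aux_full u u' hu hc h0

/-- half the symmetrised square, for a square integrable function -/
lemma sym_sq {α : Type*} [MeasurableSpace α] (μ : Measure α) [IsProbabilityMeasure μ]
    (g : α → ℝ) (hg : MemLp g 2 μ) :
    ∫⁻ z, ∫⁻ w, ENNReal.ofReal ((g z - g w) ^ 2) ∂μ ∂μ = 2 * ENNReal.ofReal (Var[g; μ]) := by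
  have hi : Integrable g μ := hg.integrable (by norm_num)
  have hi2 : Integrable (fun x => g x ^ 2) μ := hg.integrable_sq
  have h1 : ∀ z, ∫⁻ w, ENNReal.ofReal ((g z - g w) ^ 2) ∂μ =
      ENNReal.ofReal (g z ^ 2 - 2 * g z * (∫ w, g w ∂μ) + ∫ w, g w ^ 2 ∂μ) := by
    intro z
    have hI : Integrable (fun w => g z ^ 2 - 2 * g z * g w + g w ^ 2) μ :=
      ((integrable_const _).sub (hi.const_mul _)).add hi2
    have e : ∀ w, (g z - g w) ^ 2 = g z ^ 2 - 2 * g z * g w + g w ^ 2 := fun w => by ring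
    simp_rw [e]
    rw [← ofReal_integral_eq_lintegral_ofReal hI (ae_of_all _ fun w => by
        show 0 ≤ g z ^ 2 - 2 * g z * g w + g w ^ 2
        rw [← e]; positivity)]
    have hA : Integrable (fun w => g z ^ 2 - 2 * g z * g w) μ :=
      (integrable_const _).sub (hi.const_mul _)
    rw [integral_add hA hi2,
      integral_sub (integrable_const _) (hi.const_mul _), integral_const_mul]
    simp
  simp_rw [h1]
  have hv : Var[g; μ] = (∫ w, g w ^ 2 ∂μ) - (∫ w, g w ∂μ) ^ 2 := by
    rw [variance_eq_sub hg]; rfl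
  have hvn := variance_nonneg g μ
  rw [← ofReal_integral_eq_lintegral_ofReal]
  · have hA : Integrable (fun z => g z ^ 2 - 2 * g z * (∫ w, g w ∂μ)) μ :=
      hi2.sub (hi.const_mul _ |>.mul_const _)
    rw [integral_add hA (integrable_const _),
      integral_sub hi2 (hi.const_mul _ |>.mul_const _), integral_mul_const, integral_const_mul]
    rw [show (2 : ENNReal) = ENNReal.ofReal 2 by simp, ← ENNReal.ofReal_mul (by norm_num), hv]
    congr 1
    simp
    ring
  · exact (hi2.sub (hi.const_mul _ |>.mul_const _)).add (integrable_const _)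
  · refine ae_of_all _ fun z => ?_
    show 0 ≤ g z ^ 2 - 2 * g z * (∫ w, g w ∂μ) + ∫ w, g w ^ 2 ∂μ
    nlinarith [sq_nonneg (g z - ∫ w, g w ∂μ)]

lemma memLp_two_of_lint {α : Type*} [MeasurableSpace α] (μ : Measure α)
    (g : α → ℝ) (hg : AEStronglyMeasurable g μ) (h : ∫⁻ t, ENNReal.ofReal (g t ^ 2) ∂μ ≠ ⊤) :
    MemLp g 2 μ := by
  rw [memLp_two_iff_integrable_sq hg]
  refine ⟨by fun_prop, ?_⟩
  rw [hasFiniteIntegral_iff_ofReal (ae_of_all _ fun x => by positivity)]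
  exact lt_top_iff_ne_top.2 h

lemma poinc_one (g g' : ℝ → ℝ) (hu : ∀ t, HasDerivAt g (g' t) t) (hc : Continuous g') :
    ∫⁻ s, ∫⁻ t, ENNReal.ofReal ((g s - g t) ^ 2) ∂(gaussianReal 0 1) ∂(gaussianReal 0 1) ≤
      2 * ∫⁻ t, ENNReal.ofReal (g' t ^ 2) ∂(gaussianReal 0 1) := by
  have hgc : Continuous g := continuous_iff_continuousAt.2 fun t => (hu t).continuousAt
  have h := aux_gauss (fun t => g t - g 0) g' (fun t => (hu t).sub_const _) hc (by simp)
  by_cases htop : ∫⁻ t, ENNReal.ofReal (g' t ^ 2) ∂(gaussianReal 0 1) = ⊤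
  · rw [htop]; simp
  have hm : MemLp (fun t => g t - g 0) 2 (gaussianReal 0 1) :=
    memLp_two_of_lint _ _ (by fun_prop) (ne_top_of_le_ne_top htop h)
  have hs := sym_sq _ _ hm
  simp only [sub_sub_sub_cancel_right] at hs
  rw [hs]
  gcongr
  refine le_trans ?_ h
  rw [← ofReal_integral_eq_lintegral_ofReal hm.integrable_sq (ae_of_all _ fun x => by positivity)]
  exact ENNReal.ofReal_le_ofReal (variance_le_expectation_sq (by fun_prop))

/-- The standard Gaussian measure as a product measure. -/
noncomputable def gam (n : ℕ) : Measure (Fin n → ℝ) := Measure.pi fun _ => gaussianReal 0 1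

instance (n : ℕ) : IsProbabilityMeasure (gam n) := by unfold gam; infer_instance

lemma gaussDensity_prod (n : ℕ) (x : Fin n → ℝ) :
    gaussDensity n x = ∏ i, gaussianPDFReal 0 1 (x i) := by
  unfold gaussDensity gaussianPDFReal
  rw [Finset.prod_mul_distrib, ← Real.exp_sum]
  congr 1
  · rw [Finset.prod_const, Real.sqrt_eq_rpow, ← Real.rpow_neg (by positivity), ← Real.rpow_natCast,
      ← Real.rpow_mul (by positivity)]
    simp
    congr 1; ring
  · congr 1
    simp [← Finset.sum_div]

lemma gaussDensity_nonneg (n : ℕ) (x : Fin n → ℝ) : 0 ≤ gaussDensity n x := by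
  unfold gaussDensity; positivity

lemma gaussDensity_cont (n : ℕ) : Continuous (gaussDensity n) := by
  unfold gaussDensity; fun_prop

lemma gam_eq (n : ℕ) :
    gam n = volume.withDensity fun z => ENNReal.ofReal (gaussDensity n z) := by
  refine Measure.pi_eq fun s hs => ?_
  rw [withDensity_apply _ (MeasurableSet.univ_pi hs), volume_pi, Measure.restrict_pi_pi]
  simp_rw [gaussDensity_prod]
  have hIntg : ∀ i, Integrable (gaussianPDFReal 0 1) (volume.restrict (s i)) :=
    fun i => (integrable_gaussianPDFReal 0 1).restrict
  rw [← ofReal_integral_eq_lintegral_ofReal,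
    integral_fintype_prod_eq_prod (f := fun _ => gaussianPDFReal 0 1)]
  · rw [ENNReal.ofReal_prod_of_nonneg]
    · refine Finset.prod_congr rfl fun i _ => ?_
      rw [gaussianReal_apply_eq_integral _ one_ne_zero]
    · intro i _
      exact integral_nonneg fun x => gaussianPDFReal_nonneg _ _ _
  · exact Integrable.fintype_prod hIntg
  · exact ae_of_all _ fun x => Finset.prod_nonneg fun i _ => gaussianPDFReal_nonneg _ _ _

lemma mp_append (k m : ℕ) : MeasurePreserving
    (fun p : (Fin k → ℝ) × (Fin m → ℝ) => (Fin.append p.1 p.2 : Fin (k + m) → ℝ))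
    ((gam k).prod (gam m)) (gam (k + m)) := by
  have hmeas : Measurable
      (fun p : (Fin k → ℝ) × (Fin m → ℝ) => (Fin.append p.1 p.2 : Fin (k + m) → ℝ)) := by
    refine measurable_pi_iff.2 fun i => ?_
    refine Fin.addCases (fun j => ?_) (fun j => ?_) i
    · simp only [Fin.append_left]; fun_prop
    · simp only [Fin.append_right]; fun_prop
  refine ⟨hmeas, ?_⟩
  symm
  refine Measure.pi_eq fun s hs => ?_
  rw [Measure.map_apply hmeas (MeasurableSet.univ_pi hs)]
  have : (fun p : (Fin k → ℝ) × (Fin m → ℝ) => (Fin.append p.1 p.2 : Fin (k + m) → ℝ)) ⁻¹'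
      (univ.pi s) = (univ.pi fun j => s (Fin.castAdd m j)) ×ˢ
        (univ.pi fun j => s (Fin.natAdd k j)) := by
    ext p
    simp only [mem_preimage, mem_pi, mem_univ, true_imp_iff, mem_prod]
    constructor
    · intro h
      exact ⟨fun j => by simpa using h (Fin.castAdd m j), fun j => by simpa using h (Fin.natAdd k j)⟩
    · rintro ⟨h1, h2⟩ i
      refine Fin.addCases (fun j => ?_) (fun j => ?_) i
      · simpa using h1 j
      · simpa using h2 j
  rw [this, Measure.prod_prod, gam, gam, Measure.pi_pi, Measure.pi_pi, Fin.prod_univ_add]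

lemma mp_cons (m : ℕ) : MeasurePreserving
    (fun p : ℝ × (Fin m → ℝ) => (Fin.cons p.1 p.2 : Fin (m + 1) → ℝ))
    ((gaussianReal 0 1).prod (gam m)) (gam (m + 1)) := by
  have hmeas : Measurable
      (fun p : ℝ × (Fin m → ℝ) => (Fin.cons p.1 p.2 : Fin (m + 1) → ℝ)) := by
    refine measurable_pi_iff.2 fun i => ?_
    refine Fin.cases ?_ (fun j => ?_) i
    · simp only [Fin.cons_zero]; fun_prop
    · simp only [Fin.cons_succ]; fun_prop
  refine ⟨hmeas, ?_⟩
  symm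
  refine Measure.pi_eq fun s hs => ?_
  rw [Measure.map_apply hmeas (MeasurableSet.univ_pi hs)]
  have : (fun p : ℝ × (Fin m → ℝ) => (Fin.cons p.1 p.2 : Fin (m + 1) → ℝ)) ⁻¹'
      (univ.pi s) = (s 0) ×ˢ (univ.pi fun j => s (Fin.succ j)) := by
    ext p
    simp only [mem_preimage, mem_pi, mem_univ, true_imp_iff, mem_prod, Fin.forall_fin_succ,
      Fin.cons_zero, Fin.cons_succ]
  rw [this, Measure.prod_prod, gam, Measure.pi_pi, Fin.prod_univ_succ]

/-- Symmetrised Efron-Stein for two factors. -/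
lemma tensor_two {α β : Type*} [MeasurableSpace α] [MeasurableSpace β] (μ : Measure α)
    (ν : Measure β) [IsProbabilityMeasure μ] [IsProbabilityMeasure ν]
    (g : α × β → ℝ) (hg : Measurable g) :
    ∫⁻ p, ∫⁻ q, ENNReal.ofReal ((g p - g q) ^ 2) ∂(μ.prod ν) ∂(μ.prod ν) ≤
      (∫⁻ b, ∫⁻ a, ∫⁻ a', ENNReal.ofReal ((g (a, b) - g (a', b)) ^ 2) ∂μ ∂μ ∂ν) +
      ∫⁻ a, ∫⁻ b, ∫⁻ b', ENNReal.ofReal ((g (a, b) - g (a, b')) ^ 2) ∂ν ∂ν ∂μ := by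
  set D : α → β → α → β → ENNReal := fun a b a' b' => ENNReal.ofReal ((g (a, b) - g (a', b')) ^ 2)
    with hD
  have hDm : Measurable fun x : ((α × β) × α) × β => D x.1.1.1 x.1.1.2 x.1.2 x.2 := by
    simp only [hD]; fun_prop
  -- four-fold integral
  have e0 : ∫⁻ p, ∫⁻ q, ENNReal.ofReal ((g p - g q) ^ 2) ∂(μ.prod ν) ∂(μ.prod ν) =
      ∫⁻ a, ∫⁻ b, ∫⁻ a', ∫⁻ b', D a b a' b' ∂ν ∂μ ∂ν ∂μ := by
    rw [lintegral_prod _ (by fun_prop)]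
    refine lintegral_congr fun a => lintegral_congr fun b => ?_
    rw [lintegral_prod _ (by fun_prop)]
  have e1 : ∫⁻ a, ∫⁻ b, ∫⁻ a', ∫⁻ b', D a b' a' b ∂ν ∂μ ∂ν ∂μ =
      ∫⁻ a, ∫⁻ b, ∫⁻ a', ∫⁻ b', D a b a' b' ∂ν ∂μ ∂ν ∂μ := by
    refine lintegral_congr fun a => ?_
    have : ∀ b, ∫⁻ a', ∫⁻ b', D a b' a' b ∂ν ∂μ = ∫⁻ b', ∫⁻ a', D a b' a' b ∂μ ∂ν := by
      intro b
      rw [lintegral_lintegral_swap]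
      simp only [hD]; fun_prop
    simp_rw [this]
    rw [lintegral_lintegral_swap]
    · refine lintegral_congr fun b => ?_
      rw [lintegral_lintegral_swap]
      simp only [hD]; fun_prop
    · simp only [hD]
      refine Measurable.aemeasurable ?_
      refine Measurable.lintegral_prod_right' (f := fun x : (β × β) × α =>
        ENNReal.ofReal ((g (a, x.1.2) - g (x.2, x.1.1)) ^ 2)) (by fun_prop)
  have hpt : ∀ a b a' b', D a b a' b' + D a b' a' b ≤
      (D a b a' b + D a b' a' b') + (D a b a b' + D a' b a' b') := by
    intro a b a' b'
    simp only [hD]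
    rw [← ENNReal.ofReal_add, ← ENNReal.ofReal_add, ← ENNReal.ofReal_add, ← ENNReal.ofReal_add]
    · apply ENNReal.ofReal_le_ofReal
      nlinarith [sq_nonneg (g (a, b) - g (a', b) + g (a', b') - g (a, b'))]
    all_goals positivity
  have key : ∀ F G : α → β → α → β → ENNReal,
      Measurable (fun x : ((α × β) × α) × β => F x.1.1.1 x.1.1.2 x.1.2 x.2) →
      ∫⁻ a, ∫⁻ b, ∫⁻ a', ∫⁻ b', (F a b a' b' + G a b a' b') ∂ν ∂μ ∂ν ∂μ =
      (∫⁻ a, ∫⁻ b, ∫⁻ a', ∫⁻ b', F a b a' b' ∂ν ∂μ ∂ν ∂μ) +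
       ∫⁻ a, ∫⁻ b, ∫⁻ a', ∫⁻ b', G a b a' b' ∂ν ∂μ ∂ν ∂μ := by
    intro F G hF
    have m1 := Measurable.lintegral_prod_right' (ν := ν) hF
    have m2 := Measurable.lintegral_prod_right' (ν := μ) m1
    have m3 := Measurable.lintegral_prod_right' (ν := ν) m2
    have s1 : ∀ a b a', ∫⁻ b', (F a b a' b' + G a b a' b') ∂ν =
        ∫⁻ b', F a b a' b' ∂ν + ∫⁻ b', G a b a' b' ∂ν := fun a b a' =>
      lintegral_add_left (hF.comp (by fun_prop : Measurable fun b' => (((a, b), a'), b'))) _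
    simp_rw [s1]
    have s2 : ∀ a b, ∫⁻ a', (∫⁻ b', F a b a' b' ∂ν + ∫⁻ b', G a b a' b' ∂ν) ∂μ =
        ∫⁻ a', ∫⁻ b', F a b a' b' ∂ν ∂μ + ∫⁻ a', ∫⁻ b', G a b a' b' ∂ν ∂μ := fun a b =>
      lintegral_add_left (m1.comp (by fun_prop : Measurable fun a' => ((a, b), a'))) _
    simp_rw [s2]
    have s3 : ∀ a, ∫⁻ b, (∫⁻ a', ∫⁻ b', F a b a' b' ∂ν ∂μ + ∫⁻ a', ∫⁻ b', G a b a' b' ∂ν ∂μ) ∂ν =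
        ∫⁻ b, ∫⁻ a', ∫⁻ b', F a b a' b' ∂ν ∂μ ∂ν + ∫⁻ b, ∫⁻ a', ∫⁻ b', G a b a' b' ∂ν ∂μ ∂ν :=
      fun a => lintegral_add_left (m2.comp (by fun_prop : Measurable fun b => (a, b))) _
    simp_rw [s3]
    exact lintegral_add_left m3 _
  set A := ∫⁻ b, ∫⁻ a, ∫⁻ a', D a b a' b ∂μ ∂μ ∂ν with hA
  set B := ∫⁻ a, ∫⁻ b, ∫⁻ b', D a b a b' ∂ν ∂ν ∂μ with hB
  set T := ∫⁻ a, ∫⁻ b, ∫⁻ a', ∫⁻ b', D a b a' b' ∂ν ∂μ ∂ν ∂μ with hT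
  have hAm : Measurable fun x : α × β => ∫⁻ a', D x.1 x.2 a' x.2 ∂μ :=
    Measurable.lintegral_prod_right' (f := fun x : (α × β) × α => D x.1.1 x.1.2 x.2 x.1.2)
      (by simp only [hD]; fun_prop)
  have i1 : ∫⁻ a, ∫⁻ b, ∫⁻ a', ∫⁻ b', D a b a' b ∂ν ∂μ ∂ν ∂μ = A := by
    simp only [lintegral_const, measure_univ, mul_one]
    rw [lintegral_lintegral_swap]
    exact hAm.aemeasurable
  have i2 : ∫⁻ a, ∫⁻ b, ∫⁻ a', ∫⁻ b', D a b' a' b' ∂ν ∂μ ∂ν ∂μ = A := by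
    simp only [lintegral_const, measure_univ, mul_one]
    rw [hA, lintegral_lintegral_swap (μ := ν) (ν := μ) (f := fun b a => ∫⁻ a', D a b a' b ∂μ)]
    · refine lintegral_congr fun a => ?_
      rw [lintegral_lintegral_swap]
      simp only [hD]; fun_prop
    · exact (hAm.comp measurable_swap).aemeasurable
  have i3 : ∫⁻ a, ∫⁻ b, ∫⁻ a', ∫⁻ b', D a b a b' ∂ν ∂μ ∂ν ∂μ = B := by
    simp only [lintegral_const, measure_univ, mul_one, hB]
  have i4 : ∫⁻ a, ∫⁻ b, ∫⁻ a', ∫⁻ b', D a' b a' b' ∂ν ∂μ ∂ν ∂μ = B := by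
    simp only [lintegral_const, measure_univ, mul_one]
    rw [hB, lintegral_lintegral_swap]
    exact (Measurable.lintegral_prod_right' (f := fun x : (β × α) × β =>
      D x.1.2 x.1.1 x.1.2 x.2) (by simp only [hD]; fun_prop)).aemeasurable
  have hfin : T + T ≤ (A + A) + (B + B) := by
    have e2 : T + T = (∫⁻ a, ∫⁻ b, ∫⁻ a', ∫⁻ b', D a b a' b' ∂ν ∂μ ∂ν ∂μ) +
        ∫⁻ a, ∫⁻ b, ∫⁻ a', ∫⁻ b', D a b' a' b ∂ν ∂μ ∂ν ∂μ := by rw [e1]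
    rw [e2, ← key _ _ hDm]
    refine le_trans (lintegral_mono fun a => lintegral_mono fun b => lintegral_mono fun a' =>
      lintegral_mono fun b' => hpt a b a' b') ?_
    rw [key, key, key, i1, i2, i3, i4]
    all_goals simp only [hD]; fun_prop
  rw [e0]
  have h2 : 2 * T ≤ 2 * (A + B) := by
    calc 2 * T = T + T := two_mul _
      _ ≤ _ := hfin
      _ = 2 * (A + B) := by ring
  exact (ENNReal.mul_le_mul_iff_right (by norm_num) (by norm_num)).1 h2


lemma poinc_n (m : ℕ) : ∀ (g : (Fin m → ℝ) → ℝ) (D : Fin m → (Fin m → ℝ) → ℝ),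
    Continuous g → (∀ i, Continuous (D i)) →
    (∀ z i, HasDerivAt (fun t => g (Function.update z i t)) (D i z) (z i)) →
    ∫⁻ z, ∫⁻ w, ENNReal.ofReal ((g z - g w) ^ 2) ∂(gam m) ∂(gam m) ≤
      2 * ∫⁻ z, ∑ i, ENNReal.ofReal (D i z ^ 2) ∂(gam m) := by
  induction m with
  | zero =>
    intro g D _ _ _
    have : ∀ z w : Fin 0 → ℝ, g z - g w = 0 := fun z w => by
      rw [Subsingleton.elim z w, sub_self]
    simp [this]
  | succ m ih =>
    intro g D hg hD hd
    have hcons : Continuous fun p : ℝ × (Fin m → ℝ) => (Fin.cons p.1 p.2 : Fin (m + 1) → ℝ) :=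
      Continuous.finCons continuous_fst continuous_snd
    have hcons1 : ∀ b, Continuous fun a : ℝ => (Fin.cons a b : Fin (m + 1) → ℝ) := fun b =>
      Continuous.finCons continuous_id continuous_const
    have hcons2 : ∀ a : ℝ, Continuous fun b => (Fin.cons a b : Fin (m + 1) → ℝ) := fun a =>
      Continuous.finCons continuous_const continuous_id
    have hmp := mp_cons m
    have c1 : ∫⁻ z, ∫⁻ w, ENNReal.ofReal ((g z - g w) ^ 2) ∂(gam (m+1)) ∂(gam (m+1)) =
        ∫⁻ p, ∫⁻ q, ENNReal.ofReal ((g (Fin.cons p.1 p.2) - g (Fin.cons q.1 q.2)) ^ 2)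
          ∂((gaussianReal 0 1).prod (gam m)) ∂((gaussianReal 0 1).prod (gam m)) := by
      have hm : Measurable fun z => ∫⁻ w, ENNReal.ofReal ((g z - g w) ^ 2) ∂(gam (m+1)) :=
        Measurable.lintegral_prod_right' (f := fun x : (Fin (m+1) → ℝ) × (Fin (m+1) → ℝ) =>
          ENNReal.ofReal ((g x.1 - g x.2) ^ 2)) (by fun_prop)
      rw [← hmp.lintegral_comp hm]
      refine lintegral_congr fun p => ?_
      rw [← hmp.lintegral_comp (by fun_prop)]
    have c2 : ∫⁻ z, ∑ i, ENNReal.ofReal (D i z ^ 2) ∂(gam (m+1)) =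
        ∫⁻ b, ∫⁻ a, ENNReal.ofReal (D 0 (Fin.cons a b) ^ 2) ∂(gaussianReal 0 1) ∂(gam m) +
        ∫⁻ a, ∫⁻ b, ∑ i : Fin m, ENNReal.ofReal (D i.succ (Fin.cons a b) ^ 2)
          ∂(gam m) ∂(gaussianReal 0 1) := by
      have hD0 := hD 0
      have hDs := fun i : Fin m => hD i.succ
      rw [← hmp.lintegral_comp (by fun_prop)]
      simp_rw [Fin.sum_univ_succ]
      have hmm : Continuous fun p : ℝ × (Fin m → ℝ) => D 0 (Fin.cons p.1 p.2) := hD0.comp hcons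
      have hms : ∀ i : Fin m, Continuous fun p : ℝ × (Fin m → ℝ) => D i.succ (Fin.cons p.1 p.2) :=
        fun i => (hDs i).comp hcons
      rw [lintegral_add_left (by fun_prop)]
      rw [lintegral_prod_symm _ (by fun_prop), lintegral_prod _ (by fun_prop)]
    rw [c1, c2, mul_add]
    have hgm : Continuous fun p : ℝ × (Fin m → ℝ) => g (Fin.cons p.1 p.2) := hg.comp hcons
    refine (tensor_two _ _ (fun p : ℝ × (Fin m → ℝ) => g (Fin.cons p.1 p.2))
      hgm.measurable).trans ?_
    refine add_le_add ?_ ?_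
    · rw [← lintegral_const_mul' _ _ (by norm_num)]
      refine lintegral_mono fun b => ?_
      refine poinc_one (fun a => g (Fin.cons a b)) (fun a => D 0 (Fin.cons a b)) (fun t => ?_)
        ((hD 0).comp (hcons1 b))
      have := hd (Fin.cons t b) 0
      simpa only [Fin.update_cons_zero, Fin.cons_zero] using this
    · rw [← lintegral_const_mul' _ _ (by norm_num)]
      refine lintegral_mono fun a => ?_
      refine ih (fun b => g (Fin.cons a b)) (fun i b => D i.succ (Fin.cons a b))
        (hg.comp (hcons2 a)) (fun i => (hD i.succ).comp (hcons2 a)) (fun z i => ?_)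
      have := hd (Fin.cons a z) i.succ
      simpa only [← Fin.cons_update, Fin.cons_succ] using this

lemma mc_lem {α Ω : Type*} [MeasurableSpace α] [MeasurableSpace Ω] (μ : Measure α)
    [IsProbabilityMeasure μ] (P : Measure Ω) [IsProbabilityMeasure P] (g : α → ℝ)
    (hg : Measurable g) (N : ℕ) (hN : 1 ≤ N) (Y : Fin N → Ω → α) (hY : ∀ j, Measurable (Y j))
    (hlaw : ∀ j, Measure.map (Y j) P = μ) (hind : iIndepFun Y P) (G : ENNReal)
    (hG : ∫⁻ z, ∫⁻ w, ENNReal.ofReal ((g z - g w) ^ 2) ∂μ ∂μ ≤ 2 * G) :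
    ∫⁻ z, ∫⁻ ω, ENNReal.ofReal ((g z - (N : ℝ)⁻¹ * ∑ j, g (Y j ω)) ^ 2) ∂P ∂μ ≤
      ENNReal.ofReal ((1 + (N : ℝ) ^ (-(1 / 2 : ℝ))) ^ 2) * G := by
  have hN0 : (0:ℝ) < N := by exact_mod_cast hN
  by_cases hGt : G = ⊤
  · rw [hGt, ENNReal.mul_top]
    · exact le_top
    · have : 0 < (1 + (N : ℝ) ^ (-(1 / 2 : ℝ))) ^ 2 := by positivity
      exact (ENNReal.ofReal_pos.2 this).ne'
  have hfin : ∫⁻ z, ∫⁻ w, ENNReal.ofReal ((g z - g w) ^ 2) ∂μ ∂μ ≠ ⊤ :=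
    ne_top_of_le_ne_top (ENNReal.mul_ne_top (by norm_num) hGt) hG
  have hm : Measurable fun z => ∫⁻ w, ENNReal.ofReal ((g z - g w) ^ 2) ∂μ :=
    Measurable.lintegral_prod_right' (f := fun x : α × α =>
      ENNReal.ofReal ((g x.1 - g x.2) ^ 2)) (by fun_prop)
  obtain ⟨z0, hz0⟩ := (ae_lt_top hm hfin).exists
  have hL0 : MemLp (fun w => g z0 - g w) 2 μ :=
    memLp_two_of_lint _ _ (by fun_prop) hz0.ne
  have hL : MemLp g 2 μ := by
    have := (memLp_const (g z0)).sub hL0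
    refine this.ae_eq (ae_of_all _ fun w => ?_)
    simp
  rw [sym_sq μ g hL] at hG
  have hV : ENNReal.ofReal (Var[g; μ]) ≤ G :=
    (ENNReal.mul_le_mul_iff_right (by norm_num) (by norm_num)).1 hG
  set c := ∫ w, g w ∂μ with hc
  set V := Var[g; μ] with hVdef
  have hVn : 0 ≤ V := variance_nonneg _ _
  set X : Fin N → Ω → ℝ := fun j ω => g (Y j ω) with hX
  have hXL : ∀ j, MemLp (X j) 2 P := fun j => by
    have : MemLp g 2 (Measure.map (Y j) P) := by rw [hlaw]; exact hL
    exact (memLp_map_measure_iff hg.aestronglyMeasurable (hY j).aemeasurable).1 this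
  have hXE : ∀ j, ∫ ω, X j ω ∂P = c := fun j => by
    rw [hc, ← hlaw j, integral_map (hY j).aemeasurable hg.aestronglyMeasurable]
  have hXV : ∀ j, Var[X j; P] = V := fun j => by
    rw [hVdef, ← hlaw j, variance_map hg.aemeasurable (hY j).aemeasurable]; rfl
  have hSV : Var[∑ j, X j; P] = N * V := by
    rw [IndepFun.variance_sum (fun i _ => hXL i)]
    · simp [hXV]
    · intro i _ j _ hij
      exact (hind.indepFun hij).comp hg hg
  have hSL : MemLp (fun ω => (N : ℝ)⁻¹ * ∑ j, X j ω) 2 P :=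
    (memLp_finsetSum _ fun j _ => hXL j).const_mul _
  have hSE : ∫ ω, (N : ℝ)⁻¹ * ∑ j, X j ω ∂P = c := by
    rw [integral_const_mul, integral_finsetSum _ fun j _ => (hXL j).integrable (by norm_num)]
    simp only [hXE]
    simp
    field_simp
  have hSV' : Var[fun ω => (N : ℝ)⁻¹ * ∑ j, X j ω; P] = (N : ℝ)⁻¹ * V := by
    rw [variance_const_mul]
    have : (fun ω => ∑ j, X j ω) = ∑ j, X j := by ext; simp
    rw [this, hSV]; field_simp
  have h1 : ∀ z, ∫⁻ ω, ENNReal.ofReal ((g z - (N : ℝ)⁻¹ * ∑ j, g (Y j ω)) ^ 2) ∂P =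
      ENNReal.ofReal ((g z - c) ^ 2 + (N : ℝ)⁻¹ * V) := by
    intro z
    have hl : MemLp (fun ω => g z - (N : ℝ)⁻¹ * ∑ j, X j ω) 2 P := (memLp_const _).sub hSL
    rw [← ofReal_integral_eq_lintegral_ofReal hl.integrable_sq
      (ae_of_all _ fun ω => by positivity)]
    congr 1
    have hv := variance_eq_sub hl
    have hE : ∫ ω, (g z - (N : ℝ)⁻¹ * ∑ j, X j ω) ∂P = g z - c := by
      rw [integral_sub (integrable_const _) (hSL.integrable (by norm_num)), hSE]; simp
    rw [variance_const_sub hSL.aestronglyMeasurable, hSV', hE] at hv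
    rw [hv]
    simp [hX]
  simp_rw [h1]
  have hgc : MemLp (fun z => g z - c) 2 μ := hL.sub (memLp_const _)
  have hgi : Integrable (fun z => (g z - c) ^ 2 + (N : ℝ)⁻¹ * V) μ :=
    hgc.integrable_sq.add (integrable_const _)
  rw [← ofReal_integral_eq_lintegral_ofReal hgi
    (ae_of_all _ fun ω => by positivity), integral_add hgc.integrable_sq (integrable_const _),
    ← variance_eq_integral hg.aemeasurable]
  refine le_trans ?_ (mul_le_mul_right hV _)
  rw [← ENNReal.ofReal_mul (by positivity)]
  apply ENNReal.ofReal_le_ofReal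
  have hp : ((N : ℝ) ^ (-(1 / 2 : ℝ))) ^ 2 = (N : ℝ)⁻¹ := by
    rw [← Real.rpow_natCast, ← Real.rpow_mul hN0.le, ← Real.rpow_neg_one]; norm_num
  have hp0 : 0 ≤ (N : ℝ) ^ (-(1 / 2 : ℝ)) := by positivity
  have : (1 + (N : ℝ) ^ (-(1 / 2 : ℝ))) ^ 2 * V =
      V + (N : ℝ)⁻¹ * V + 2 * (N : ℝ) ^ (-(1 / 2 : ℝ)) * V := by rw [← hp]; ring
  rw [this]
  simp only [integral_const, probReal_univ, one_smul]
  have : 0 ≤ 2 * (N : ℝ) ^ (-(1 / 2 : ℝ)) * V := by positivity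
  linarith

lemma sum_sq_orth {n : ℕ} (A : Matrix (Fin n) (Fin n) ℝ) (hA : Aᵀ * A = 1) (x : Fin n → ℝ) :
    ∑ i, (A *ᵥ x) i ^ 2 = ∑ i, x i ^ 2 := by
  have : (A *ᵥ x) ⬝ᵥ (A *ᵥ x) = x ⬝ᵥ x := by
    rw [Matrix.dotProduct_mulVec, Matrix.vecMul_mulVec, hA]
    simp
  simpa [dotProduct, pow_two] using this

lemma mp_rot {n : ℕ} (A : Matrix (Fin n) (Fin n) ℝ) (hA : Aᵀ * A = 1) :
    MeasurePreserving (fun x => A *ᵥ x) (gam n) (gam n) := by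
  have hdet : A.det * A.det = 1 := by
    have := congrArg Matrix.det hA
    simpa using this
  have hdet0 : A.det ≠ 0 := by
    intro h; rw [h] at hdet; simp at hdet
  have habs : |(A.det)⁻¹| = 1 := by
    rw [abs_inv, inv_eq_one]
    have : |A.det| * |A.det| = 1 := by rw [← abs_mul, hdet, abs_one]
    nlinarith [abs_nonneg A.det]
  have hmeas : Measurable fun x : Fin n → ℝ => A *ᵥ x := by
    have : Continuous fun x : Fin n → ℝ => A *ᵥ x := by fun_prop
    exact this.measurable
  have hvol : MeasurePreserving (fun x : Fin n → ℝ => A *ᵥ x) volume volume := by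
    refine ⟨hmeas, ?_⟩
    have := Real.map_matrix_volume_pi_eq_smul_volume_pi hdet0
    rw [habs, ENNReal.ofReal_one, one_smul] at this
    exact this
  refine ⟨hmeas, ?_⟩
  rw [gam_eq]
  ext s hs
  have hdm : Measurable fun z => ENNReal.ofReal (gaussDensity n z) :=
    (gaussDensity_cont n).measurable.ennreal_ofReal
  rw [Measure.map_apply hmeas hs, withDensity_apply _ (hmeas hs), withDensity_apply _ hs,
    ← hvol.setLIntegral_comp_preimage hs hdm]
  simp only [gaussDensity, sum_sq_orth A hA]

lemma lin_alg (k m : ℕ) (W Wh : Matrix (Fin (k + m)) (Fin (k + m)) ℝ) (hW : Wᵀ * W = 1)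
    (hWh : Whᵀ * Wh = 1) (Λ : Fin (k + m) → ℝ) (hΛ : ∀ i, 0 ≤ Λ i) (ε : ℝ) (hε : 0 < ε)
    (hpert : ‖W - Wh‖ ≤ ε) :
    ∑ j : Fin m, (Whᵀ * (W * Matrix.diagonal Λ * Wᵀ) * Wh) (Fin.natAdd k j) (Fin.natAdd k j) ≤
      (ε * Real.sqrt (∑ j : Fin k, Λ (Fin.castAdd m j)) +
          Real.sqrt (∑ j : Fin m, Λ (Fin.natAdd k j))) ^ 2 := by
  set M := Wᵀ * Wh with hM
  have hMt : Mᵀ = Whᵀ * W := by simp [hM]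
  have e : Whᵀ * (W * Matrix.diagonal Λ * Wᵀ) * Wh = Mᵀ * Matrix.diagonal Λ * M := by
    rw [hMt, hM]; simp only [Matrix.mul_assoc]
  have e1 : ∀ j, (Mᵀ * Matrix.diagonal Λ * M) j j = ∑ i, Λ i * M i j ^ 2 := by
    intro j
    rw [Matrix.mul_apply]
    refine Finset.sum_congr rfl fun i _ => ?_
    rw [Matrix.mul_diagonal, Matrix.transpose_apply]; ring
  have hsub : ∀ (B : Matrix (Fin (k + m)) (Fin (k + m)) ℝ) i,
      ∑ j : Fin m, B i (Fin.natAdd k j) ^ 2 ≤ ∑ j, B i j ^ 2 := by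
    intro B i
    rw [Fin.sum_univ_add]
    have : 0 ≤ ∑ j : Fin k, B i (Fin.castAdd m j) ^ 2 := Finset.sum_nonneg fun _ _ => sq_nonneg _
    linarith
  have hWh' : Wh * Whᵀ = 1 := mul_eq_one_comm.1 hWh
  have hMM : M * Mᵀ = 1 := by
    rw [hMt, hM, Matrix.mul_assoc, ← Matrix.mul_assoc Wh, hWh', Matrix.one_mul, hW]
  have r1 : ∀ i, ∑ j, M i j ^ 2 = 1 := by
    intro i
    have := congrFun (congrFun hMM i) i
    simpa [Matrix.mul_apply, pow_two] using this
  have r2 : ∀ i, ∑ j, (Wᵀ * (Wh - W)) i j ^ 2 ≤ ε ^ 2 := by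
    intro i
    set w : EuclideanSpace ℝ (Fin (k + m)) := WithLp.toLp 2 (fun l => W l i) with hw
    have h := Matrix.l2_opNorm_mulVec ((W - Wh)ᴴ) w
    rw [Matrix.l2_opNorm_conjTranspose] at h
    have hwn : ‖w‖ = 1 := by
      rw [EuclideanSpace.norm_eq]
      have := congrFun (congrFun hW i) i
      simp [Matrix.mul_apply] at this
      simp [hw, pow_two, this]
    rw [hwn, mul_one] at h
    have h2 := h.trans hpert
    have h3 := pow_le_pow_left₀ (norm_nonneg _) h2 2
    refine le_trans (le_of_eq ?_) h3
    rw [EuclideanSpace.norm_sq_eq]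
    refine Finset.sum_congr rfl fun j _ => ?_
    rw [Real.norm_eq_abs, sq_abs, ← neg_sq]
    congr 1
    simp only [hw, Matrix.mulVec, dotProduct, Matrix.mul_apply, ← Finset.sum_neg_distrib]
    refine Finset.sum_congr rfl fun l _ => ?_
    simp
    ring
  have r3 : ∀ (i : Fin k) (j : Fin m), M (Fin.castAdd m i) (Fin.natAdd k j) =
      (Wᵀ * (Wh - W)) (Fin.castAdd m i) (Fin.natAdd k j) := by
    intro i j
    rw [Matrix.mul_sub, hW, Matrix.sub_apply, Matrix.one_apply_ne, sub_zero]
    intro h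
    have := congrArg Fin.val h
    simp at this
    omega
  rw [e]
  simp_rw [e1]
  rw [Finset.sum_comm]
  simp_rw [← Finset.mul_sum]
  rw [Fin.sum_univ_add]
  have b1 : ∑ i : Fin k, Λ (Fin.castAdd m i) * ∑ j : Fin m, M (Fin.castAdd m i) (Fin.natAdd k j) ^ 2
      ≤ ε ^ 2 * ∑ i : Fin k, Λ (Fin.castAdd m i) := by
    rw [Finset.mul_sum]
    refine Finset.sum_le_sum fun i _ => ?_
    rw [mul_comm]
    refine mul_le_mul_of_nonneg_right ?_ (hΛ _)
    simp_rw [r3]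
    exact (hsub _ _).trans (r2 _)
  have b2 : ∑ i : Fin m, Λ (Fin.natAdd k i) * ∑ j : Fin m, M (Fin.natAdd k i) (Fin.natAdd k j) ^ 2
      ≤ ∑ i : Fin m, Λ (Fin.natAdd k i) := by
    refine Finset.sum_le_sum fun i _ => ?_
    exact mul_le_of_le_one_right (hΛ _) ((hsub _ _).trans (r1 _).le)
  have s1 := Real.sq_sqrt (Finset.sum_nonneg (s := Finset.univ) fun (i : Fin k) _ => hΛ (Fin.castAdd m i))
  have s2 := Real.sq_sqrt (Finset.sum_nonneg (s := Finset.univ) fun (i : Fin m) _ => hΛ (Fin.natAdd k i))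
  have p1 := Real.sqrt_nonneg (∑ i : Fin k, Λ (Fin.castAdd m i))
  have p2 := Real.sqrt_nonneg (∑ i : Fin m, Λ (Fin.natAdd k i))
  have p3 := mul_nonneg (mul_nonneg hε.le p1) p2
  calc _ ≤ _ := add_le_add b1 b2
    _ ≤ _ := by
      rw [add_sq, mul_pow, s1, s2]
      linarith


lemma pgrad_cont {n : ℕ} (f : (Fin n → ℝ) → ℝ) (hf : ContDiff ℝ 1 f) (i : Fin n) :
    Continuous fun x => pgrad f x i := by
  unfold pgrad
  exact (hf.continuous_fderiv one_ne_zero).clm_apply continuous_const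

lemma lint_gam (n : ℕ) (F : (Fin n → ℝ) → ENNReal) (hF : Measurable F) :
    ∫⁻ x, F x ∂(gam n) = ∫⁻ x, F x * ENNReal.ofReal (gaussDensity n x) := by
  rw [gam_eq, lintegral_withDensity_eq_lintegral_mul _
    (gaussDensity_cont n).measurable.ennreal_ofReal hF]
  exact lintegral_congr fun x => mul_comm _ _

lemma mulVec_append (k m : ℕ) (Wh : Matrix (Fin (k + m)) (Fin (k + m)) ℝ) (y : Fin k → ℝ)
    (z : Fin m → ℝ) : Wh *ᵥ (Fin.append y z) = Wh.submatrix id (Fin.castAdd m) *ᵥ y +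
      Wh.submatrix id (Fin.natAdd k) *ᵥ z := by
  ext l
  simp [Matrix.mulVec, dotProduct, Fin.sum_univ_add]

lemma transp_append (k m : ℕ) (Wh : Matrix (Fin (k + m)) (Fin (k + m)) ℝ) (hWh : Whᵀ * Wh = 1)
    (y : Fin k → ℝ) (z : Fin m → ℝ) :
    (Wh.submatrix id (Fin.castAdd m))ᵀ *ᵥ (Wh *ᵥ (Fin.append y z)) = y := by
  have h : Whᵀ *ᵥ (Wh *ᵥ (Fin.append y z)) = Fin.append y z := by
    rw [Matrix.mulVec_mulVec, hWh, Matrix.one_mulVec]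
  ext i
  have := congrFun h (Fin.castAdd m i)
  rw [Fin.append_left] at this
  rw [← this]
  rfl

lemma grad_trace (k m : ℕ) (f : (Fin (k + m) → ℝ) → ℝ) (hf : ContDiff ℝ 1 f)
    (hsq : ∀ i, Integrable fun x => (pgrad f x i) ^ 2 * gaussDensity (k + m) x)
    (Wh : Matrix (Fin (k + m)) (Fin (k + m)) ℝ) :
    ∫⁻ x, ∑ j : Fin m, ENNReal.ofReal ((∑ l, pgrad f x l * Wh l (Fin.natAdd k j)) ^ 2)
      ∂(gam (k + m)) =
    ENNReal.ofReal (∑ j : Fin m, (Whᵀ *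
      (Matrix.of fun i j => ∫ x, pgrad f x i * pgrad f x j * gaussDensity (k + m) x) * Wh)
        (Fin.natAdd k j) (Fin.natAdd k j)) := by
  have hpc := pgrad_cont f hf
  have hdc := gaussDensity_cont (k + m)
  have hdn := gaussDensity_nonneg (k + m)
  have hij : ∀ i j, Integrable fun x => pgrad f x i * pgrad f x j * gaussDensity (k + m) x := by
    intro i j
    have := hpc i
    have := hpc j
    refine ((hsq i).add (hsq j)).mono' (by fun_prop : Continuous _).aestronglyMeasurable
      (ae_of_all _ fun x => ?_)
    rw [Real.norm_eq_abs, abs_mul, abs_of_nonneg (hdn x)]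
    simp only [Pi.add_apply]
    rw [← add_mul]
    refine mul_le_mul_of_nonneg_right ?_ (hdn x)
    rw [abs_le]
    constructor <;> nlinarith [sq_nonneg (pgrad f x i + pgrad f x j),
      sq_nonneg (pgrad f x i - pgrad f x j)]
  have hexp : ∀ (c : Fin (k + m)) x, (∑ l, pgrad f x l * Wh l c) ^ 2 * gaussDensity (k + m) x =
      ∑ l, ∑ l', Wh l' c * Wh l c * (pgrad f x l' * pgrad f x l * gaussDensity (k + m) x) := by
    intro c x
    rw [pow_two, Finset.sum_mul_sum, Finset.sum_mul]
    refine Finset.sum_congr rfl fun l _ => ?_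
    rw [Finset.sum_mul]
    refine Finset.sum_congr rfl fun l' _ => ?_
    ring
  have hI : ∀ c : Fin (k + m), Integrable fun x =>
      (∑ l, pgrad f x l * Wh l c) ^ 2 * gaussDensity (k + m) x := by
    intro c
    simp_rw [hexp]
    exact integrable_finsetSum _ fun l _ => integrable_finsetSum _ fun l' _ =>
      (hij l' l).const_mul _
  have hval : ∀ c : Fin (k + m), ∫ x, (∑ l, pgrad f x l * Wh l c) ^ 2 * gaussDensity (k + m) x =
      (Whᵀ * (Matrix.of fun i j => ∫ x, pgrad f x i * pgrad f x j * gaussDensity (k + m) x) * Wh)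
        c c := by
    intro c
    simp_rw [hexp]
    rw [integral_finsetSum _ fun l _ => integrable_finsetSum _ fun l' _ =>
      (hij l' l).const_mul _, Matrix.mul_apply]
    refine Finset.sum_congr rfl fun l _ => ?_
    rw [integral_finsetSum _ fun l' _ => (hij l' l).const_mul _, Matrix.mul_apply, Finset.sum_mul]
    refine Finset.sum_congr rfl fun l' _ => ?_
    rw [integral_const_mul, Matrix.of_apply, Matrix.transpose_apply]
    ring
  have hqc : ∀ c : Fin (k + m), Continuous fun x => (∑ l, pgrad f x l * Wh l c) ^ 2 := fun c => by
    fun_prop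
  have hqm : ∀ c : Fin (k + m), Measurable fun x =>
      ENNReal.ofReal ((∑ l, pgrad f x l * Wh l c) ^ 2) := fun c =>
    (hqc c).measurable.ennreal_ofReal
  rw [lintegral_finsetSum _ fun j _ => hqm _, ENNReal.ofReal_sum_of_nonneg]
  · refine Finset.sum_congr rfl fun j _ => ?_
    rw [lint_gam _ _ (hqm _), ← hval, ofReal_integral_eq_lintegral_ofReal (hI _)
      (ae_of_all _ fun x => mul_nonneg (sq_nonneg _) (hdn x))]
    exact lintegral_congr fun x => (ENNReal.ofReal_mul (sq_nonneg _)).symm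
  · intro j _
    rw [← hval]
    exact integral_nonneg fun x => mul_nonneg (sq_nonneg _) (hdn x)

lemma slice_deriv (k m : ℕ) (f : (Fin (k + m) → ℝ) → ℝ) (hf : ContDiff ℝ 1 f)
    (Wh : Matrix (Fin (k + m)) (Fin (k + m)) ℝ) (y : Fin k → ℝ) (z : Fin m → ℝ) (i : Fin m) :
    HasDerivAt (fun t => f (Wh.submatrix id (Fin.castAdd m) *ᵥ y +
      Wh.submatrix id (Fin.natAdd k) *ᵥ Function.update z i t))
      (∑ l, pgrad f (Wh.submatrix id (Fin.castAdd m) *ᵥ y +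
        Wh.submatrix id (Fin.natAdd k) *ᵥ z) l * Wh l (Fin.natAdd k i)) (z i) := by
  set A1 := Wh.submatrix id (Fin.castAdd m)
  set A2 := Wh.submatrix id (Fin.natAdd k) with hA2
  set T : (Fin m → ℝ) →L[ℝ] (Fin (k + m) → ℝ) := LinearMap.toContinuousLinearMap A2.mulVecLin
    with hT
  have h1 : HasDerivAt (fun t => A1 *ᵥ y + A2 *ᵥ Function.update z i t) (T (Pi.single i 1)) (z i) := by
    have := (T.hasFDerivAt (x := Function.update z i (z i))).comp_hasDerivAt (z i)
      (hasDerivAt_update z i (z i))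
    exact this.const_add (A1 *ᵥ y)
  have h2 : HasFDerivAt f (fderiv ℝ f (A1 *ᵥ y + A2 *ᵥ z)) (A1 *ᵥ y + A2 *ᵥ Function.update z i (z i)) := by
    rw [Function.update_eq_self]
    exact (hf.differentiable one_ne_zero _).hasFDerivAt
  refine (h2.comp_hasDerivAt (z i) h1).congr_deriv ?_
  have e : T (Pi.single i 1) = ∑ l, Wh l (Fin.natAdd k i) • (Pi.single l 1 : Fin (k + m) → ℝ) := by
    ext l
    simp [hT, hA2, Finset.sum_apply, Pi.single_apply]
  rw [e, map_sum]
  refine Finset.sum_congr rfl fun l _ => ?_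
  rw [map_smul, smul_eq_mul, mul_comm]
  rfl

/-- Perturbed total Monte Carlo error bound in the Gaussian case: with
`C = ∫ ∇f ∇fᵀ ρX dx = W Λ Wᵀ`, perturbed orthogonal `Ŵ` (`Wh` below) with `‖W - Ŵ‖ ≤ ε` in
spectral norm, `ĝ` the conditional expectation over the perturbed inactive variable, and `ĝ_N`
its `N`-sample Monte Carlo approximation with i.i.d. samples of density `φ_m` jointly
measurable in `(ŷ,ω)`, one has
`E[∫ (f(x) - f_{ĝ_N}(x,·))² ρX(x) dx] ≤ (1+N^{-1/2})²(ε(λ₁+⋯+λ_k)^{1/2} + (λ_{k+1}+⋯+λ_{k+m})^{1/2})²`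
(STATEMENT 13). -/
theorem perturbed_monte_carlo_total_mse_bound
    (k m : ℕ)
    (f : (Fin (k + m) → ℝ) → ℝ)
    (hf : ContDiff ℝ 1 f)
    (hsq : ∀ i, Integrable fun x => (pgrad f x i) ^ 2 * gaussDensity (k + m) x)
    (W : Matrix (Fin (k + m)) (Fin (k + m)) ℝ)
    (hW : Wᵀ * W = 1)
    (Λ : Fin (k + m) → ℝ)
    (hΛdesc : ∀ i j, i ≤ j → Λ j ≤ Λ i)
    (hΛnonneg : ∀ i, 0 ≤ Λ i)
    (hC : (Matrix.of fun i j => ∫ x, pgrad f x i * pgrad f x j * gaussDensity (k + m) x) =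
      W * Matrix.diagonal Λ * Wᵀ)
    (Wh : Matrix (Fin (k + m)) (Fin (k + m)) ℝ)
    (hWh : Whᵀ * Wh = 1)
    (ε : ℝ) (hε : 0 < ε)
    (hpert : ‖W - Wh‖ ≤ ε)
    (gh : (Fin k → ℝ) → ℝ)
    (hgh : ∀ y, gh y = ∫ z, f (Wh.submatrix id (Fin.castAdd m) *ᵥ y +
      Wh.submatrix id (Fin.natAdd k) *ᵥ z) * gaussDensity m z)
    (Ω : Type*) [MeasurableSpace Ω] (P : Measure Ω) [IsProbabilityMeasure P]
    (N : ℕ) (hN : 1 ≤ N)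
    (Z : Fin N → (Fin k → ℝ) → Ω → (Fin m → ℝ))
    (hZmeas : ∀ j, Measurable fun p : (Fin k → ℝ) × Ω => Z j p.1 p.2)
    (hZlaw : ∀ j y, Measure.map (Z j y) P =
      volume.withDensity fun z => ENNReal.ofReal (gaussDensity m z))
    (hZindep : ∀ y, iIndepFun (m := fun _ => inferInstance) (fun j => Z j y) P)
    (ghN : (Fin k → ℝ) → Ω → ℝ)
    (hghN : ∀ y ω, ghN y ω = (N : ℝ)⁻¹ * ∑ j, f (Wh.submatrix id (Fin.castAdd m) *ᵥ y +
      Wh.submatrix id (Fin.natAdd k) *ᵥ Z j y ω)) :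
    ∫ ω, (∫ x, (f x -
        ghN ((Wh.submatrix id (Fin.castAdd m))ᵀ *ᵥ x) ω) ^ 2 * gaussDensity (k + m) x) ∂P ≤
      (1 + (N : ℝ) ^ (-(1 / 2 : ℝ))) ^ 2 *
        (ε * Real.sqrt (∑ j : Fin k, Λ (Fin.castAdd m j)) +
          Real.sqrt (∑ j : Fin m, Λ (Fin.natAdd k j))) ^ 2 := by
  set A1 := Wh.submatrix id (Fin.castAdd m) with hA1
  set A2 := Wh.submatrix id (Fin.natAdd k) with hA2
  have hfc : Continuous f := hf.continuous
  have hfm : Measurable f := hfc.measurable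
  have hpc := pgrad_cont f hf
  have hdc := gaussDensity_cont (k + m)
  have hdn := gaussDensity_nonneg (k + m)
  have hA1m : Measurable fun y : Fin k → ℝ => A1 *ᵥ y :=
    (by fun_prop : Continuous fun y : Fin k → ℝ => A1 *ᵥ y).measurable
  have hA2c : Continuous fun z : Fin m → ℝ => A2 *ᵥ z := by fun_prop
  have hA2m : Measurable fun z : Fin m → ℝ => A2 *ᵥ z := hA2c.measurable
  have hA1tm : Measurable fun x : Fin (k + m) → ℝ => A1ᵀ *ᵥ x :=
    (by fun_prop : Continuous fun x : Fin (k + m) → ℝ => A1ᵀ *ᵥ x).measurable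
  have hghm : Measurable fun p : (Fin k → ℝ) × Ω => ghN p.1 p.2 := by
    simp_rw [hghN]
    refine Measurable.const_mul (Finset.measurable_fun_sum _ fun j _ => ?_) _
    exact hfm.comp ((hA1m.comp measurable_fst).add (hA2m.comp (hZmeas j)))
  have hFm : Measurable fun p : (Fin (k + m) → ℝ) × Ω =>
      ENNReal.ofReal ((f p.1 - ghN (A1ᵀ *ᵥ p.1) p.2) ^ 2) := by
    refine Measurable.ennreal_ofReal (Measurable.pow_const (Measurable.sub
      (hfm.comp measurable_fst) ?_) 2)
    exact hghm.comp ((hA1tm.comp measurable_fst).prodMk measurable_snd)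
  set c := (1 + (N : ℝ) ^ (-(1 / 2 : ℝ))) ^ 2 with hc
  have hcn : 0 ≤ c := sq_nonneg _
  have hRn : 0 ≤ c * (ε * Real.sqrt (∑ j : Fin k, Λ (Fin.castAdd m j)) +
          Real.sqrt (∑ j : Fin m, Λ (Fin.natAdd k j))) ^ 2 := mul_nonneg hcn (sq_nonneg _)
  refine (ENNReal.ofReal_le_ofReal_iff hRn).1 ?_
  -- pass to lower integrals
  have st1 : ENNReal.ofReal (∫ ω, (∫ x, (f x - ghN (A1ᵀ *ᵥ x) ω) ^ 2 *
      gaussDensity (k + m) x) ∂P) ≤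
      ∫⁻ ω, ∫⁻ x, ENNReal.ofReal ((f x - ghN (A1ᵀ *ᵥ x) ω) ^ 2) ∂(gam (k + m)) ∂P := by
    refine (Real.ofReal_le_enorm _).trans ?_
    refine (enorm_integral_le_lintegral_enorm _).trans ?_
    refine lintegral_mono fun ω => ?_
    refine (enorm_integral_le_lintegral_enorm _).trans ?_
    rw [lint_gam _ (fun x => ENNReal.ofReal ((f x - ghN (A1ᵀ *ᵥ x) ω) ^ 2))
      (hFm.comp (measurable_id.prodMk measurable_const))]
    refine lintegral_mono fun x => ?_
    rw [Real.enorm_eq_ofReal (mul_nonneg (sq_nonneg _) (hdn x)), ENNReal.ofReal_mul (sq_nonneg _)]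
  refine st1.trans ?_
  rw [lintegral_lintegral_swap
    (f := fun ω x => ENNReal.ofReal ((f x - ghN (A1ᵀ *ᵥ x) ω) ^ 2))
    (hFm.comp measurable_swap).aemeasurable]
  have hGm : Measurable fun x => ∫⁻ ω, ENNReal.ofReal ((f x - ghN (A1ᵀ *ᵥ x) ω) ^ 2) ∂P :=
    hFm.lintegral_prod_right'
  have hmp := (mp_rot Wh hWh).comp (mp_append k m)
  rw [← hmp.lintegral_comp hGm]
  refine (lintegral_prod (μ := gam k) (ν := gam m) _
    (hGm.comp hmp.measurable).aemeasurable).le.trans ?_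
  have hDm : Measurable fun x => ∑ j : Fin m,
      ENNReal.ofReal ((∑ l, pgrad f x l * Wh l (Fin.natAdd k j)) ^ 2) := by
    refine Finset.measurable_fun_sum _ fun j _ => Measurable.ennreal_ofReal
      (Measurable.pow_const (Finset.measurable_fun_sum _ fun l _ => ?_) 2)
    exact (hpc l).measurable.mul_const _
  have st2 : ∀ y, ∫⁻ z, ∫⁻ ω, ENNReal.ofReal ((f (((fun x => Wh *ᵥ x) ∘
      fun p : (Fin k → ℝ) × (Fin m → ℝ) => (Fin.append p.1 p.2 : Fin (k + m) → ℝ)) (y, z)) -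
      ghN (A1ᵀ *ᵥ (((fun x => Wh *ᵥ x) ∘ fun p : (Fin k → ℝ) × (Fin m → ℝ) =>
        (Fin.append p.1 p.2 : Fin (k + m) → ℝ)) (y, z))) ω) ^ 2) ∂P ∂(gam m) ≤
      ENNReal.ofReal c * ∫⁻ z, ∑ j : Fin m,
      ENNReal.ofReal ((∑ l, pgrad f (Wh *ᵥ (Fin.append y z)) l * Wh l (Fin.natAdd k j)) ^ 2)
        ∂(gam m) := by
    intro y
    simp only [Function.comp_apply]
    simp_rw [hA1, transp_append k m Wh hWh, mulVec_append, hghN, ← hA1, ← hA2]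
    refine mc_lem (gam m) P (fun z => f (A1 *ᵥ y + A2 *ᵥ z)) (by fun_prop) N hN (fun j => Z j y)
      (fun j => (hZmeas j).comp measurable_prodMk_left) (fun j => by rw [hZlaw, gam_eq])
      (hZindep y) _ ?_
    refine poinc_n m (fun z => f (A1 *ᵥ y + A2 *ᵥ z)) (fun j z =>
      ∑ l, pgrad f (A1 *ᵥ y + A2 *ᵥ z) l * Wh l (Fin.natAdd k j)) (by fun_prop) (fun j => ?_)
      (fun z i => slice_deriv k m f hf Wh y z i)
    refine continuous_finsetSum _ fun l _ => ?_
    exact ((hpc l).comp (continuous_const.add hA2c)).mul continuous_const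
  refine (lintegral_mono st2).trans ?_
  rw [lintegral_const_mul' _ _ ENNReal.ofReal_ne_top]
  have st3 := lintegral_prod (μ := gam k) (ν := gam m) _ (hDm.comp hmp.measurable).aemeasurable
  simp only [Function.comp_apply] at st3
  rw [← st3]
  have st4 := hmp.lintegral_comp hDm
  simp only [Function.comp_apply] at st4
  rw [st4, grad_trace k m f hf hsq, hC, ← ENNReal.ofReal_mul hcn]
  exact ENNReal.ofReal_le_ofReal (mul_le_mul_of_nonneg_left
    (lin_alg k m W Wh hW hWh Λ hΛnonneg ε hε hpert) hcn)
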